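/- Let X be an uncountable compact metric space and n ≥ 1. The set of functions f in C(X, ℝⁿ) such that the topological (covering) dimension of f(X) equals n is dense in C(X, ℝⁿ). -/

import Mathlib

open Set Metric Filter MeasureTheory TopologicalSpace

noncomputable def coveringNumber {X : Type*} [MetricSpace X] (δ : ℝ) (F : Set X) : ℕ∞ :=
  sInf {m : ℕ∞ | ∃ C : Finset (Set X), (C.card : ℕ∞) = m ∧
    (∀ U ∈ C, IsOpen U ∧ Metric.diam U ≤ δ) ∧ F ⊆ ⋃ U ∈ C, U}

noncomputable def packingNumber {X : Type*} [MetricSpace X] (δ : ℝ) (F : Set X) : ℕ∞ :=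
  sSup {m : ℕ∞ | ∃ S : Finset X, (S.card : ℕ∞) = m ∧ (↑S : Set X) ⊆ F ∧
    (S : Set X).Pairwise fun x y => Disjoint (Metric.closedBall x δ) (Metric.closedBall y δ)}

noncomputable def upperBoxDim {X : Type*} [MetricSpace X] (F : Set X) : ℝ :=
  Filter.limsup (fun δ : ℝ => Real.log ((coveringNumber δ F).toNat) / (-Real.log δ))
    (nhdsWithin 0 (Set.Ioi 0))

noncomputable def lowerBoxDim {X : Type*} [MetricSpace X] (F : Set X) : ℝ :=
  Filter.liminf (fun δ : ℝ => Real.log ((coveringNumber δ F).toNat) / (-Real.log δ))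
    (nhdsWithin 0 (Set.Ioi 0))

noncomputable def packingDim {X : Type*} [MetricSpace X] (F : Set X) : ℝ :=
  sInf {s : ℝ | ∃ E : ℕ → Set X, F ⊆ ⋃ i, E i ∧ ∀ i, upperBoxDim (E i) ≤ s}

noncomputable def covDim (Y : Type*) [TopologicalSpace Y] : ℕ∞ :=
  sInf {m : ℕ∞ | ∀ (ι : Type) (U : ι → Set Y), (∀ i, IsOpen (U i)) → (⋃ i, U i) = Set.univ →
    ∃ (κ : Type) (V : κ → Set Y), (∀ j, IsOpen (V j)) ∧ (⋃ j, V j) = Set.univ ∧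
      (∀ j, ∃ i, V j ⊆ U i) ∧ ∀ y : Y, ENat.card {j : κ // y ∈ V j} ≤ m + 1}

open scoped NNReal Topology

theorem exists_lipschitzOnWith_smul {E F : Type*} [PseudoMetricSpace E] [NormedAddCommGroup F]
    [NormedSpace ℝ F] {s : Set E} (hs : IsCompact s) {a : E → ℝ} {f : E → F}
    (ha : ∃ K, LipschitzOnWith K a s) (hf : ∃ K, LipschitzOnWith K f s) :
    ∃ K, LipschitzOnWith K (fun x => a x • f x) s := by
  obtain ⟨K, ha⟩ := ha
  obtain ⟨L, hf⟩ := hf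
  obtain ⟨A, hA⟩ := hs.exists_bound_of_continuousOn ha.continuousOn
  obtain ⟨B, hB⟩ := hs.exists_bound_of_continuousOn hf.continuousOn
  refine ⟨_, LipschitzOnWith.of_dist_le' (K := A * L + K * B) fun x hx y hy => ?_⟩
  have h₁ := ha.dist_le_mul x hx y hy
  have h₂ := hf.dist_le_mul x hx y hy
  have h₃ := hA x hx
  have h₄ := hB y hy
  rw [dist_eq_norm] at h₁ h₂ ⊢
  have : a x • f x - a y • f y = a x • (f x - f y) + (a x - a y) • f y := by module
  calc ‖a x • f x - a y • f y‖ ≤ ‖a x‖ * ‖f x - f y‖ + ‖a x - a y‖ * ‖f y‖ := by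
        rw [this, ← norm_smul, ← norm_smul]; exact norm_add_le _ _
    _ ≤ A * (L * dist x y) + (K * dist x y) * B := by
        gcongr
        exact (norm_nonneg _).trans h₃
    _ = _ := by ring

theorem exists_lipschitzOnWith_inv {E : Type*} [PseudoMetricSpace E] {s : Set E}
    (hs : IsCompact s) {a : E → ℝ} (ha : ∃ K, LipschitzOnWith K a s) (hpos : ∀ x ∈ s, 0 < a x) :
    ∃ K, LipschitzOnWith K (fun x => (a x)⁻¹) s := by
  obtain ⟨K, ha⟩ := ha
  obtain ⟨A, hA⟩ := hs.exists_bound_of_continuousOn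
    (ha.continuousOn.inv₀ fun x hx => (hpos x hx).ne')
  refine ⟨_, LipschitzOnWith.of_dist_le' (K := A * A * K) fun x hx y hy => ?_⟩
  have h₁ := ha.dist_le_mul y hy x hx
  have hx' := (hpos x hx).ne'
  have hy' := (hpos y hy).ne'
  rw [dist_eq_norm] at h₁ ⊢
  have : (a x)⁻¹ - (a y)⁻¹ = (a x)⁻¹ * (a y)⁻¹ * (a y - a x) := by field_simp
  calc ‖(a x)⁻¹ - (a y)⁻¹‖ = ‖(a x)⁻¹‖ * ‖(a y)⁻¹‖ * ‖a y - a x‖ := by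
        rw [this, norm_mul, norm_mul]
    _ ≤ A * A * (K * dist x y) := by
        have h3 : ‖(a x)⁻¹‖ ≤ A := hA x hx
        have h4 : ‖(a y)⁻¹‖ ≤ A := hA y hy
        rw [dist_comm x y]
        have : 0 ≤ A := (norm_nonneg _).trans h3
        gcongr
    _ = _ := by ring

theorem exists_lipschitzOnWith_add {E F : Type*} [PseudoMetricSpace E] [NormedAddCommGroup F]
    {s : Set E} {f g : E → F} (hf : ∃ K, LipschitzOnWith K f s) (hg : ∃ K, LipschitzOnWith K g s) :
    ∃ K, LipschitzOnWith K (fun x => f x + g x) s := by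
  obtain ⟨K, hf⟩ := hf
  obtain ⟨L, hg⟩ := hg
  exact ⟨_, hf.add hg⟩

theorem exists_lipschitzOnWith_sum {E F ι : Type*} [PseudoMetricSpace E] [NormedAddCommGroup F]
    {s : Set E} (t : Finset ι) {f : ι → E → F} (hf : ∀ i, ∃ K, LipschitzOnWith K (f i) s) :
    ∃ K, LipschitzOnWith K (fun x => ∑ i ∈ t, f i x) s := by
  classical
  induction t using Finset.induction_on with
  | empty => exact ⟨0, by simp⟩
  | insert i t hi ih =>
    simp only [Finset.sum_insert hi]
    exact exists_lipschitzOnWith_add (hf i) ih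

/-- Coordinatewise projection of `ℝⁿ` onto the cube of radius `r` centred at the origin. -/
def clampCube {n : ℕ} (r : ℝ) (x : Fin n → ℝ) : Fin n → ℝ := fun i => max (-r) (min r (x i))

theorem lipschitzWith_clampCube {n : ℕ} (r : ℝ) :
    LipschitzWith 1 (clampCube r : (Fin n → ℝ) → Fin n → ℝ) := by
  refine LipschitzWith.of_dist_le_mul fun x y => ?_
  refine (dist_pi_le_iff (by positivity)).2 fun i => ?_
  exact (((LipschitzWith.eval i).const_min r).const_max (-r)).dist_le_mul x y

theorem clampCube_eq_self {n : ℕ} {r : ℝ} {x : Fin n → ℝ} (hx : ‖x‖ ≤ r) : clampCube r x = x := by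
  funext i
  have := abs_le.1 ((norm_le_pi_norm x i).trans hx)
  simp [clampCube, this.1, this.2]

theorem norm_clampCube_le {n : ℕ} {r : ℝ} (hr : 0 ≤ r) (x : Fin n → ℝ) : ‖clampCube r x‖ ≤ r := by
  refine (pi_norm_le_iff_of_nonneg hr).2 fun i => ?_
  rw [Real.norm_eq_abs, abs_le]
  exact ⟨le_max_left _ _, max_le (by linarith) (min_le_left _ _)⟩

theorem norm_clampCube_eq {n : ℕ} {r : ℝ} (hr : 0 < r) {x : Fin n → ℝ} (hx : r ≤ ‖x‖) :
    ‖clampCube r x‖ = r := by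
  refine le_antisymm (norm_clampCube_le hr.le x) ?_
  obtain ⟨i, hi⟩ : ∃ i, r ≤ |x i| := by
    by_contra! h
    exact hx.not_gt ((pi_norm_lt_iff hr).2 h)
  refine le_trans ?_ (norm_le_pi_norm _ i)
  rw [Real.norm_eq_abs, clampCube]
  rcases le_abs'.1 hi with h | h
  · rw [min_eq_right (by linarith), max_eq_left h, abs_neg]; exact le_abs_self r
  · rw [min_eq_left h, max_eq_right (by linarith)]; exact le_abs_self r

/-- Evaluation at `1` of the polynomial `t ↦ det (1 + t A)` is a fixed linear combination of its
values at `n + 1` distinct nodes. -/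
theorem det_one_add_eq_sum {n : ℕ} {τ : Fin (n + 1) → ℝ} (hτ : Function.Injective τ)
    (A : (Fin n → ℝ) →L[ℝ] Fin n → ℝ) :
    (1 + A).det = ∑ i, (Lagrange.basis Finset.univ τ i).eval 1 * (1 + τ i • A).det := by
  set M := LinearMap.toMatrix' (A : (Fin n → ℝ) →ₗ[ℝ] Fin n → ℝ) with hM
  set p : Polynomial ℝ :=
    ((Polynomial.X : Polynomial ℝ) • M.map Polynomial.C +
      (1 : Matrix (Fin n) (Fin n) ℝ).map Polynomial.C).det with hp
  have heval (t : ℝ) : p.eval t = (1 + t • A).det := by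
    have h₁ : p.eval t = (t • M + 1).det := by
      rw [hp, ← Polynomial.coe_evalRingHom, RingHom.map_det]
      congr 1
      ext i j
      rcases eq_or_ne i j with rfl | h
      · simp [mul_comm t]
      · simp [Matrix.one_apply_ne h, mul_comm t]
    rw [h₁, ContinuousLinearMap.det, ← LinearMap.det_toMatrix']
    congr 1
    rw [hM]
    simp [add_comm, Module.End.one_eq_id]
  have hdeg : p.degree < (Finset.univ : Finset (Fin (n + 1))).card := by
    refine lt_of_le_of_lt (Polynomial.degree_le_natDegree) ?_
    have := Polynomial.natDegree_det_X_add_C_le M 1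
    rw [← hp] at this
    simp only [Fintype.card_fin, Finset.card_univ] at this ⊢
    exact_mod_cast Nat.lt_succ_of_le this
  have h := Lagrange.eq_interpolate (v := τ) hτ.injOn hdeg
  have h₁ := congrArg (Polynomial.eval 1) h
  rw [heval, one_smul] at h₁
  rw [h₁, Lagrange.interpolate_apply, Polynomial.eval_finsetSum]
  exact Finset.sum_congr rfl fun i _ => by rw [Polynomial.eval_mul, Polynomial.eval_C, heval]; ring

theorem volume_image_eq_zero_of_lipschitzWith {n : ℕ} {K : ℝ≥0} {h : (Fin n → ℝ) → Fin n → ℝ}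
    (hh : LipschitzWith K h) {s : Set (Fin n → ℝ)} (hs : volume s = 0) : volume (h '' s) = 0 := by
  rw [← hausdorffMeasure_pi_real] at hs ⊢
  refine le_antisymm ((hh.hausdorffMeasure_image_le (by positivity) s).trans ?_) bot_le
  rw [hs, mul_zero]

theorem LipschitzWith.bijective_add_self {E : Type*} [NormedAddCommGroup E] [CompleteSpace E]
    {K : ℝ≥0} (hK : K < 1) {v : E → E} (hv : LipschitzWith K v) :
    Function.Bijective fun x => x + v x := by
  have hc (y : E) : ContractingWith K fun x => y - v x :=
    ⟨hK, by simpa using (LipschitzWith.const y).sub hv⟩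
  refine ⟨fun x y hxy => ?_, fun y => ?_⟩
  · refine (hc (x + v x)).fixedPoint_unique' ?_ ?_
    · simp [Function.IsFixedPt]
    · simp only at hxy
      simp [Function.IsFixedPt, hxy]
  · refine ⟨(hc y).fixedPoint, ?_⟩
    have := (hc y).fixedPoint_isFixedPt
    simp only [Function.IsFixedPt] at this
    exact sub_eq_iff_eq_add.1 this |>.symm

/-- A small Lipschitz perturbation of the identity supported in the unit cube preserves the volume
of the cube. -/
theorem eventually_setIntegral_det_one_add_smul {n : ℕ} {L : ℝ≥0} {u : (Fin n → ℝ) → Fin n → ℝ}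
    (hu : LipschitzWith L u) (hsupp : ∀ x, 1 ≤ ‖x‖ → u x = 0) :
    ∀ᶠ t : ℝ in 𝓝 0,
      IntegrableOn (fun x => (1 + t • fderiv ℝ u x).det)
        (ball 0 1 ∩ {x | DifferentiableAt ℝ u x}) ∧
      ∫ x in ball 0 1 ∩ {x | DifferentiableAt ℝ u x}, (1 + t • fderiv ℝ u x).det =
        volume.real (ball (0 : Fin n → ℝ) 1) := by
  set D := ball 0 1 ∩ {x | DifferentiableAt ℝ u x} with hD
  have hDm : MeasurableSet D :=
    measurableSet_ball.inter (measurableSet_of_differentiableAt ℝ u)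
  have hDnull : volume (ball 0 1 \ D) = 0 := by
    refine measure_mono_null ?_ (ae_iff.1 (hu.ae_differentiableAt (μ := volume)))
    rintro x ⟨hx, hxD⟩ hd
    exact hxD ⟨hx, hd⟩
  have hdetpos : ∀ᶠ A : (Fin n → ℝ) →L[ℝ] Fin n → ℝ in 𝓝 0, 0 < (1 + A).det := by
    have hcont : Continuous fun A : (Fin n → ℝ) →L[ℝ] Fin n → ℝ => (1 + A).det :=
      ContinuousLinearMap.continuous_det.comp (continuous_const.add continuous_id)
    refine hcont.continuousAt.eventually (lt_mem_nhds ?_)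
    simp [ContinuousLinearMap.det]
  obtain ⟨η, hη, hηdet⟩ := Metric.eventually_nhds_iff.1 hdetpos
  have hsmall : ∀ᶠ t : ℝ in 𝓝 0, ‖t‖ * L < min 1 η := by
    have : Continuous fun t : ℝ => ‖t‖ * L := by fun_prop
    refine this.continuousAt.eventually (gt_mem_nhds ?_)
    simpa using hη
  filter_upwards [hsmall] with t ht
  set h : (Fin n → ℝ) → Fin n → ℝ := fun x => x + t • u x with hh
  have htu : LipschitzWith (‖t‖₊ * L) fun x => t • u x := (lipschitzWith_smul t).comp hu
  have hbij : Function.Bijective h :=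
    LipschitzWith.bijective_add_self
      (by rw [← NNReal.coe_lt_coe]; simpa using ht.trans_le (min_le_left _ _)) htu
  have hout (x : Fin n → ℝ) (hx : 1 ≤ ‖x‖) : h x = x := by simp [hh, hsupp x hx]
  have hball : h '' ball 0 1 = ball 0 1 := by
    ext y
    simp only [mem_image, mem_ball_zero_iff]
    constructor
    · rintro ⟨x, hx, rfl⟩
      by_contra! hy
      rw [hbij.1 (hout _ hy)] at hy
      exact hx.not_ge hy
    · intro hy
      obtain ⟨x, rfl⟩ := hbij.2 y
      refine ⟨x, ?_, rfl⟩
      by_contra! hx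
      rw [hout x hx] at hy
      exact hy.not_ge hx
  have hlip : LipschitzWith (1 + ‖t‖₊ * L) h := LipschitzWith.id.add htu
  have hvol : volume (h '' D) = volume (ball (0 : Fin n → ℝ) 1) := by
    refine le_antisymm (measure_mono ((image_mono inter_subset_left).trans hball.subset)) ?_
    calc volume (ball (0 : Fin n → ℝ) 1) = volume (h '' D ∪ h '' (ball 0 1 \ D)) := by
          rw [← image_union, union_sdiff_cancel inter_subset_left, hball]
      _ ≤ volume (h '' D) + volume (h '' (ball 0 1 \ D)) := measure_union_le _ _
      _ = volume (h '' D) := by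
          rw [volume_image_eq_zero_of_lipschitzWith hlip hDnull, add_zero]
  have hderiv : ∀ x ∈ D, HasFDerivWithinAt h (1 + t • fderiv ℝ u x) D x := fun x hx =>
    ((hasFDerivAt_id x).add ((hx.2.hasFDerivAt).const_smul t)).hasFDerivWithinAt
  have habs (x : Fin n → ℝ) : |(1 + t • fderiv ℝ u x).det| = (1 + t • fderiv ℝ u x).det := by
    refine abs_of_pos (hηdet ?_)
    rw [dist_zero_right, norm_smul]
    refine lt_of_le_of_lt ?_ (ht.trans_le (min_le_right _ _))
    gcongr
    exact norm_fderiv_le_of_lipschitz ℝ hu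
  constructor
  · have := (integrableOn_image_iff_integrableOn_abs_det_fderiv_smul volume hDm hderiv
      hbij.1.injOn fun _ => (1 : ℝ)).1
        (integrableOn_const (by rw [hvol]; exact measure_ball_lt_top.ne))
    simpa only [habs, smul_eq_mul, mul_one] using this
  · have := integral_image_eq_integral_abs_det_fderiv_smul volume hDm hderiv
      hbij.1.injOn fun _ => (1 : ℝ)
    simp only [habs, smul_eq_mul, mul_one] at this
    rw [← this, setIntegral_const, Measure.real, hvol, smul_eq_mul, mul_one, Measure.real]

theorem det_fderiv_eq_zero_of_norm_eq_one {n : ℕ} {f : (Fin n → ℝ) → Fin n → ℝ} {x : Fin n → ℝ}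
    {f' : (Fin n → ℝ) →L[ℝ] Fin n → ℝ} (hf : HasFDerivAt f f' x)
    (hnorm : ∀ᶠ y in 𝓝 x, ‖f y‖ = 1) : f'.det = 0 := by
  obtain ⟨i, hi⟩ : ∃ i, 1 ≤ |f x i| := by
    by_contra! h
    exact hnorm.self_of_nhds.not_lt ((pi_norm_lt_iff one_pos).2 h)
  have hle : ∀ᶠ y in 𝓝 x, |f y i| ≤ 1 :=
    hnorm.mono fun y hy => (norm_le_pi_norm (f y) i).trans_eq hy
  have hfi := (hasFDerivAt_pi'.1 hf) i
  have hextr : IsLocalExtr (fun y => f y i) x := by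
    rcases le_abs'.1 hi with h | h
    · exact Or.inl (hle.mono fun y hy => by simpa using h.trans (abs_le.1 hy).1)
    · exact Or.inr (hle.mono fun y hy => (abs_le.1 hy).2.trans h)
  have hzero := hextr.hasFDerivAt_eq_zero hfi
  by_contra hdet
  have hsurj := (LinearMap.equivOfDetNeZero (f' : (Fin n → ℝ) →ₗ[ℝ] Fin n → ℝ) hdet).surjective
  obtain ⟨v, hv⟩ := hsurj (Pi.single i 1)
  have h₁ : f' v = Pi.single i 1 := hv
  have h₂ : f' v i = 0 := DFunLike.congr_fun hzero v
  simp [h₁] at h₂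

/-- The boundary of the cube is not a Lipschitz retract of the cube. -/
theorem not_exists_lipschitz_retraction_cube {n : ℕ} {K : ℝ≥0} {f : (Fin n → ℝ) → Fin n → ℝ}
    (hf : LipschitzOnWith K f (closedBall 0 1)) (hnorm : ∀ x ∈ closedBall 0 1, ‖f x‖ = 1)
    (hid : ∀ x, ‖x‖ = 1 → f x = x) : False := by
  set u : (Fin n → ℝ) → Fin n → ℝ := fun x => f (clampCube 1 x) - clampCube 1 x with hu_def
  have hmem (x : Fin n → ℝ) : clampCube 1 x ∈ closedBall 0 1 := by
    simpa using norm_clampCube_le zero_le_one x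
  have hu : LipschitzWith (K * 1 + 1) u := by
    refine LipschitzWith.sub ?_ (lipschitzWith_clampCube 1)
    exact lipschitzOnWith_univ.1
      (hf.comp (lipschitzWith_clampCube 1).lipschitzOnWith fun x _ => hmem x)
  have hsupp (x : Fin n → ℝ) (hx : 1 ≤ ‖x‖) : u x = 0 := by
    simp [hu_def, hid _ (norm_clampCube_eq one_pos hx)]
  obtain ⟨ε, hε, hsmall⟩ := Metric.eventually_nhds_iff.1
    (eventually_setIntegral_det_one_add_smul hu hsupp)
  set D := ball 0 1 ∩ {x | DifferentiableAt ℝ u x} with hD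
  have hDm : MeasurableSet D :=
    measurableSet_ball.inter (measurableSet_of_differentiableAt ℝ u)
  have hdet : ∀ x ∈ D, (1 + fderiv ℝ u x).det = 0 := by
    intro x hx
    refine det_fderiv_eq_zero_of_norm_eq_one (f := fun y => y + u y)
      ((hasFDerivAt_id x).add hx.2.hasFDerivAt) ?_
    filter_upwards [isOpen_ball.mem_nhds hx.1] with y hy
    have hy' : ‖y‖ ≤ 1 := (mem_ball_zero_iff.1 hy).le
    simpa [hu_def, clampCube_eq_self hy'] using hnorm y (by simpa using hy')
  let τ : Fin (n + 1) → ℝ := fun i => ε * ((i : ℝ) / (n + 1))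
  have hτ : Function.Injective τ := by
    intro i j hij
    have : (n : ℝ) + 1 ≠ 0 := by positivity
    simp only [τ] at hij
    field_simp at hij
    exact Fin.ext (by exact_mod_cast hij)
  have hτε (i : Fin (n + 1)) : dist (τ i) 0 < ε := by
    have h₁ : (i : ℝ) / (n + 1) < 1 := by
      rw [div_lt_one (by positivity)]
      exact_mod_cast i.2
    rw [Real.dist_0_eq_abs, abs_of_nonneg (by positivity)]
    exact mul_lt_of_lt_one_right hε h₁
  have hsum : ∑ i, (Lagrange.basis Finset.univ τ i).eval 1 = 1 := by
    rw [← Polynomial.eval_finsetSum, Lagrange.sum_basis hτ.injOn Finset.univ_nonempty,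
      Polynomial.eval_one]
  have key : (0 : ℝ) = volume.real (ball (0 : Fin n → ℝ) 1) :=
    calc (0 : ℝ) = ∫ x in D, (1 + fderiv ℝ u x).det := by
          rw [setIntegral_congr_fun hDm hdet, integral_zero]
      _ = ∫ x in D, ∑ i, (Lagrange.basis Finset.univ τ i).eval 1 *
            (1 + τ i • fderiv ℝ u x).det := by
          exact integral_congr_ae (.of_forall fun x => det_one_add_eq_sum hτ _)
      _ = ∑ i, (Lagrange.basis Finset.univ τ i).eval 1 *
            ∫ x in D, (1 + τ i • fderiv ℝ u x).det := by
          rw [integral_finsetSum _ fun i _ => ((hsmall (hτε i)).1.const_mul _)]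
          simp only [integral_const_mul]
      _ = volume.real (ball (0 : Fin n → ℝ) 1) := by
          simp only [(hsmall (hτε _)).2]
          rw [← Finset.sum_mul, hsum, one_mul]
  exact (measure_ball_pos volume (0 : Fin n → ℝ) one_pos).ne'
    ((measureReal_eq_zero_iff measure_ball_lt_top.ne).1 key.symm)

/-- A Lipschitz map on the cube which is close to the identity attains the value `0`. -/
theorem exists_eq_zero_of_norm_sub_self_le {n : ℕ} {K : ℝ≥0} {g : (Fin n → ℝ) → Fin n → ℝ}
    (hg : LipschitzOnWith K g (closedBall 0 1)) (hclose : ∀ x ∈ closedBall 0 1, ‖g x - x‖ ≤ 1 / 2) :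
    ∃ x ∈ closedBall 0 1, g x = 0 := by
  by_contra! hne
  have hQ : IsCompact (closedBall (0 : Fin n → ℝ) 1) := isCompact_closedBall 0 1
  set χ : (Fin n → ℝ) → ℝ := fun x => min 1 (2 - 2 * ‖x‖) with hχ
  have hχlip : ∃ K, LipschitzOnWith K χ (closedBall 0 1) := by
    refine ⟨_, LipschitzWith.lipschitzOnWith
      ((LipschitzWith.of_dist_le' (K := 2) fun x y => ?_).const_min 1)⟩
    rw [Real.dist_eq, dist_eq_norm, show 2 - 2 * ‖x‖ - (2 - 2 * ‖y‖) = 2 * (‖y‖ - ‖x‖) by ring,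
      abs_mul, abs_two, norm_sub_rev]
    gcongr
    exact abs_norm_sub_norm_le y x
  set h : (Fin n → ℝ) → Fin n → ℝ := fun x => x + χ x • (g x - x) with hh
  have hhlip : ∃ K, LipschitzOnWith K h (closedBall 0 1) :=
    exists_lipschitzOnWith_add ⟨1, LipschitzWith.id.lipschitzOnWith⟩
      (exists_lipschitzOnWith_smul hQ hχlip ⟨_, hg.sub LipschitzWith.id.lipschitzOnWith⟩)
  have hpos : ∀ x ∈ closedBall 0 1, 0 < ‖h x‖ := by
    intro x hx
    have hx1 : ‖x‖ ≤ 1 := mem_closedBall_zero_iff.1 hx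
    rcases le_or_gt ‖x‖ (1 / 2) with hx2 | hx2
    · have : χ x = 1 := min_eq_left (by linarith)
      simpa [hh, this] using hne x hx
    · have h0 : 0 ≤ χ x := le_min zero_le_one (by linarith)
      have h1 : χ x ≤ 1 := min_le_left _ _
      have h2 : ‖χ x • (g x - x)‖ ≤ 1 / 2 := by
        rw [norm_smul, Real.norm_of_nonneg h0]
        exact (mul_le_of_le_one_left (norm_nonneg _) h1).trans (hclose x hx)
      have h3 : ‖x‖ ≤ ‖h x‖ + ‖χ x • (g x - x)‖ := by
        simpa [hh] using norm_sub_le (h x) (χ x • (g x - x))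
      linarith
  have hnlip : ∃ K, LipschitzOnWith K (fun x => ‖h x‖) (closedBall 0 1) := by
    obtain ⟨L, hL⟩ := hhlip
    exact ⟨_, lipschitzWith_one_norm.comp_lipschitzOnWith hL⟩
  obtain ⟨L, hL⟩ := exists_lipschitzOnWith_smul hQ (exists_lipschitzOnWith_inv hQ hnlip hpos) hhlip
  refine not_exists_lipschitz_retraction_cube hL (fun x hx => ?_) fun x hx => ?_
  · rw [norm_smul, norm_inv, norm_norm, inv_mul_cancel₀ (hpos x hx).ne']
  · have : χ x = 0 := by simp [hχ, hx]
    simp [hh, this, hx]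

theorem affineSpan_image_ne_top_of_card_le {n : ℕ} {κ : Type*} (p : κ → Fin n → ℝ) {t : Finset κ}
    (ht : t.card ≤ n) : affineSpan ℝ (p '' t) ≠ ⊤ := by
  classical
  intro h
  rcases Nat.eq_zero_or_pos t.card with h0 | h0
  · rw [Finset.card_eq_zero.1 h0] at h
    simp at h
  · have h₁ := finrank_vectorSpan_image_finset_le ℝ p t (n := t.card - 1) (by omega)
    rw [Finset.coe_image, ← direction_affineSpan, h, AffineSubspace.direction_top, finrank_top,
      Module.finrank_fin_fun] at h₁
    omega

/-- **Lebesgue covering theorem**: a fine finite open cover of the cube `[-1, 1]ⁿ` has a point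
which belongs to more than `n` of its members. -/
theorem exists_lt_card_of_cube_subset_iUnion {n : ℕ} (hn : 1 ≤ n) {κ : Type*} (s : Finset κ)
    {W : κ → Set (Fin n → ℝ)} {p : κ → Fin n → ℝ} (hW : ∀ j, IsOpen (W j))
    (hWp : ∀ j, W j ⊆ ball (p j) (1 / 4)) (hcover : closedBall 0 1 ⊆ ⋃ j ∈ s, W j) :
    ∃ x ∈ closedBall 0 1, n < {j ∈ (s : Set κ) | x ∈ W j}.ncard := by
  classical
  by_contra! hcard
  have hQ : IsCompact (closedBall (0 : Fin n → ℝ) 1) := isCompact_closedBall 0 1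
  have hne (j : κ) : (W j)ᶜ.Nonempty := by
    refine ⟨p j + fun _ => 1, fun h => ?_⟩
    have h₁ := hWp j h
    rw [mem_ball, dist_eq_norm, add_sub_cancel_left] at h₁
    have h₂ := (norm_le_pi_norm (fun _ : Fin n => (1 : ℝ)) ⟨0, hn⟩).trans_lt h₁
    norm_num at h₂
  set φ : κ → (Fin n → ℝ) → ℝ := fun j x => infDist x (W j)ᶜ with hφ
  have hφ0 (j : κ) (x : Fin n → ℝ) : 0 ≤ φ j x := infDist_nonneg
  have hφpos (j : κ) (x : Fin n → ℝ) : 0 < φ j x ↔ x ∈ W j := by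
    rw [← (hW j).isClosed_compl.notMem_iff_infDist_pos (hne j), notMem_compl_iff]
  have hφlip (j : κ) : ∃ K, LipschitzOnWith K (φ j) (closedBall 0 1) :=
    ⟨1, (lipschitz_infDist_pt _).lipschitzOnWith⟩
  have hSpos : ∀ x ∈ closedBall 0 1, 0 < ∑ j ∈ s, φ j x := by
    intro x hx
    obtain ⟨j, hj, hxj⟩ := mem_iUnion₂.1 (hcover hx)
    exact Finset.sum_pos' (fun j _ => hφ0 j x) ⟨j, hj, (hφpos j x).2 hxj⟩
  set g : (Fin n → ℝ) → Fin n → ℝ := fun x => s.centerMass (fun j => φ j x) p with hg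
  have hglip : ∃ K, LipschitzOnWith K g (closedBall 0 1) := by
    refine exists_lipschitzOnWith_smul hQ
      (exists_lipschitzOnWith_inv hQ (exists_lipschitzOnWith_sum s hφlip) hSpos)
      (exists_lipschitzOnWith_sum s fun j => exists_lipschitzOnWith_smul hQ (hφlip j)
        ⟨0, LipschitzWith.lipschitzOnWith (LipschitzWith.const _)⟩)
  have hgmem : ∀ x ∈ closedBall 0 1, g x ∈ convexHull ℝ (p '' {j ∈ (s : Set κ) | x ∈ W j}) := by
    intro x hx
    simp only [hg]
    rw [← Finset.centerMass_filter_ne_zero]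
    refine (convex_convexHull ℝ _).centerMass_mem (fun j _ => hφ0 j x) ?_ fun j hj => ?_
    · rw [Finset.sum_filter_ne_zero]
      exact hSpos x hx
    · obtain ⟨hjs, hj0⟩ := Finset.mem_filter.1 hj
      exact subset_convexHull ℝ _
        ⟨j, ⟨hjs, (hφpos j x).1 (lt_of_le_of_ne (hφ0 j x) (Ne.symm hj0))⟩, rfl⟩
  have hgclose : ∀ x ∈ closedBall 0 1, dist (g x) x < 1 / 4 := by
    intro x hx
    refine convexHull_min ?_ (convex_ball x (1 / 4)) (hgmem x hx)
    rintro _ ⟨j, ⟨-, hj⟩, rfl⟩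
    exact mem_ball_comm.1 (hWp j hj)
  have hnull : volume (⋃ t ∈ s.powerset.filter fun t => t.card ≤ n,
      (affineSpan ℝ (p '' t) : Set (Fin n → ℝ))) = 0 := by
    refine (measure_biUnion_null_iff (Finset.countable_toSet _)).2 fun t ht => ?_
    exact Measure.addHaar_affineSubspace _ _
      (affineSpan_image_ne_top_of_card_le p (Finset.mem_filter.1 ht).2)
  obtain ⟨c, hc, hcN⟩ : ∃ c ∈ ball (0 : Fin n → ℝ) (1 / 4),
      c ∉ ⋃ t ∈ s.powerset.filter fun t => t.card ≤ n,
        (affineSpan ℝ (p '' t) : Set (Fin n → ℝ)) := by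
    by_contra! h
    exact (measure_ball_pos volume (0 : Fin n → ℝ) (by norm_num : (0 : ℝ) < 1 / 4)).ne'
      (measure_mono_null h hnull)
  obtain ⟨L, hL⟩ := hglip
  obtain ⟨x, hx, hx0⟩ := exists_eq_zero_of_norm_sub_self_le (g := fun x => g x - c)
    (hL.sub (LipschitzWith.const c).lipschitzOnWith) fun x hx => by
      have h₁ := hgclose x hx
      rw [dist_eq_norm] at h₁
      rw [mem_ball_zero_iff] at hc
      have h₂ := norm_sub_le (g x - x) c
      rw [sub_right_comm]
      linarith
  refine hcN (mem_iUnion₂.2 ⟨s.filter fun j => x ∈ W j, ?_, ?_⟩)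
  · have h₁ := hcard x hx
    have h₂ : {j ∈ (s : Set κ) | x ∈ W j} = ↑(s.filter fun j => x ∈ W j) := by
      ext j
      simp
    rw [h₂, ncard_coe_finset] at h₁
    exact Finset.mem_filter.2 ⟨Finset.mem_powerset.2 (Finset.filter_subset _ _), h₁⟩
  · rw [← sub_eq_zero.1 hx0]
    have := convexHull_subset_affineSpan (𝕜 := ℝ) _ (hgmem x hx)
    simpa using this

/-- The `k`-th open cube of side `δ` in the tiling of `ℝⁿ` translated by `j δ / (n + 1)` along the
diagonal. -/
def gridCube {n : ℕ} (δ : ℝ) (jk : Fin (n + 1) × (Fin n → ℤ)) : Set (Fin n → ℝ) :=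
  univ.pi fun i =>
    Ioo (δ * (jk.2 i + (jk.1 : ℝ) / (n + 1))) (δ * (jk.2 i + 1 + (jk.1 : ℝ) / (n + 1)))

theorem isOpen_gridCube {n : ℕ} (δ : ℝ) (jk : Fin (n + 1) × (Fin n → ℤ)) :
    IsOpen (gridCube δ jk) :=
  isOpen_set_pi finite_univ fun _ _ => isOpen_Ioo

theorem dist_lt_of_mem_gridCube {n : ℕ} {δ : ℝ} (hδ : 0 < δ) {jk : Fin (n + 1) × (Fin n → ℤ)}
    {x y : Fin n → ℝ} (hx : x ∈ gridCube δ jk) (hy : y ∈ gridCube δ jk) : dist x y < δ := by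
  refine (dist_pi_lt_iff hδ).2 fun i => ?_
  have h₁ := hx i (mem_univ i)
  have h₂ := hy i (mem_univ i)
  rw [mem_Ioo] at h₁ h₂
  rw [Real.dist_eq, abs_lt]
  constructor <;> linarith [h₁.1, h₁.2, h₂.1, h₂.2]

/-- Two cubes of the same tiling that share a point coincide. -/
theorem eq_of_mem_gridCube {n : ℕ} {δ : ℝ} (hδ : 0 < δ) {j : Fin (n + 1)} {k l : Fin n → ℤ}
    {x : Fin n → ℝ} (hk : x ∈ gridCube δ (j, k)) (hl : x ∈ gridCube δ (j, l)) : k = l := by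
  funext i
  have h₁ := hk i (mem_univ i)
  have h₂ := hl i (mem_univ i)
  simp only [mem_Ioo] at h₁ h₂
  have h₃ := lt_of_mul_lt_mul_left (h₁.1.trans h₂.2) hδ.le
  have h₄ := lt_of_mul_lt_mul_left (h₂.1.trans h₁.2) hδ.le
  have h₅ : (k i : ℝ) < l i + 1 := by linarith
  have h₆ : (l i : ℝ) < k i + 1 := by linarith
  norm_cast at h₅ h₆
  omega

theorem iUnion_gridCube {n : ℕ} {δ : ℝ} (hδ : 0 < δ) :
    ⋃ jk : Fin (n + 1) × (Fin n → ℤ), gridCube δ jk = univ := by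
  refine eq_univ_of_forall fun x => ?_
  by_contra hx
  simp only [mem_iUnion, not_exists] at hx
  have hbad (j : Fin (n + 1)) : ∃ i : Fin n, ∃ k : ℤ, x i / δ - (j : ℝ) / (n + 1) = k := by
    by_contra! h
    refine hx (j, fun i => ⌊x i / δ - (j : ℝ) / (n + 1)⌋) fun i _ => ?_
    have h₁ := lt_of_le_of_ne (Int.floor_le (x i / δ - (j : ℝ) / (n + 1))) (h i _).symm
    have h₂ := Int.lt_floor_add_one (x i / δ - (j : ℝ) / (n + 1))
    rw [mem_Ioo, mul_comm, mul_comm δ, ← lt_div_iff₀ hδ, ← div_lt_iff₀ hδ]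
    constructor <;> linarith
  choose i k hik using hbad
  obtain ⟨a, b, hab, hi⟩ := Fintype.exists_ne_map_eq_of_card_lt i (by simp)
  have ha := hik a
  have hb := hik b
  rw [hi] at ha
  have hn : (0 : ℝ) < n + 1 := by positivity
  have h₁ : (a : ℝ) - b = (k b - k a) * (n + 1) := by
    rw [← ha, ← hb]
    field_simp
    ring
  have h₂ : ((a : ℕ) : ℤ) - (b : ℕ) = (k b - k a) * (n + 1) := by exact_mod_cast h₁
  have h₃ := a.2
  have h₄ := b.2
  have h₅ : k b - k a = 0 := by
    by_contra h0
    rcases lt_or_gt_of_ne h0 with h | h <;> nlinarith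
  rw [h₅, zero_mul] at h₂
  exact hab (Fin.ext (by omega))

theorem covDim_le_of_isCompact {n : ℕ} {K : Set (Fin n → ℝ)} (hK : IsCompact K)
    (hne : K.Nonempty) : covDim K ≤ n := by
  refine sInf_le fun ι U hU hcover => ?_
  have : CompactSpace K := isCompact_iff_compactSpace.1 hK
  obtain ⟨δ, hδ, hLeb⟩ := lebesgue_number_lemma_of_metric isCompact_univ hU hcover.ge
  refine ⟨Fin (n + 1) × (Fin n → ℤ), fun jk => (↑) ⁻¹' gridCube δ jk,
    fun jk => (isOpen_gridCube δ jk).preimage continuous_subtype_val, ?_, fun jk => ?_,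
    fun y => ?_⟩
  · rw [← preimage_iUnion, iUnion_gridCube hδ, preimage_univ]
  · rcases eq_empty_or_nonempty ((↑) ⁻¹' gridCube δ jk : Set K) with h | ⟨x, hx⟩
    · obtain ⟨i, -⟩ := hLeb ⟨_, hne.some_mem⟩ (mem_univ _)
      exact ⟨i, h.subset.trans (empty_subset _)⟩
    · obtain ⟨i, hi⟩ := hLeb x (mem_univ x)
      exact ⟨i, fun z hz => hi (dist_lt_of_mem_gridCube hδ hz hx)⟩
  · have hinj : Function.Injective
        fun v : {jk : Fin (n + 1) × (Fin n → ℤ) // y ∈ ((↑) ⁻¹' gridCube δ jk : Set K)} =>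
          v.1.1 := by
      rintro ⟨⟨j, k⟩, hk⟩ ⟨⟨j', l⟩, hl⟩ (rfl : j = j')
      obtain rfl := eq_of_mem_gridCube hδ hk hl
      rfl
    refine (ENat.card_le_card_of_injective hinj).trans ?_
    simp

theorem le_covDim_of_closedBall_subset {n : ℕ} (hn : 1 ≤ n) {K : Set (Fin n → ℝ)}
    (hK : IsCompact K) {c : Fin n → ℝ} {r : ℝ} (hr : 0 < r) (hcK : closedBall c r ⊆ K) :
    n ≤ covDim K := by
  refine le_sInf fun m hm => ?_
  by_contra! hmn
  have : CompactSpace K := isCompact_iff_compactSpace.1 hK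
  obtain ⟨κ, V, hV, hVcover, hVball, hVcard⟩ := hm K (fun q => ball q (r / 4))
    (fun q => isOpen_ball)
    (eq_univ_of_forall fun q => mem_iUnion.2 ⟨q, mem_ball_self (by positivity)⟩)
  obtain ⟨t, ht⟩ := isCompact_univ.elim_finite_subcover V hV hVcover.ge
  choose q hq using hVball
  have hV' (j : κ) : ∃ O : Set (Fin n → ℝ), IsOpen O ∧ (↑) ⁻¹' O = V j :=
    isOpen_induced_iff.1 (hV j)
  choose O hO hOV using hV'
  set A : (Fin n → ℝ) → Fin n → ℝ := fun x => c + r • x with hA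
  have hAcont : Continuous A := by fun_prop
  have hAdist (x y : Fin n → ℝ) : dist (A x) (A y) = r * dist x y := by
    rw [hA, dist_add_left, dist_smul₀, Real.norm_of_nonneg hr.le]
  have hAsurj (y : Fin n → ℝ) : A (r⁻¹ • (y - c)) = y := by
    simp [hA, smul_smul, mul_inv_cancel₀ hr.ne']
  have hAK (x : Fin n → ℝ) (hx : x ∈ closedBall 0 1) : A x ∈ K := by
    refine hcK ?_
    rw [mem_closedBall, dist_eq_norm, hA, add_sub_cancel_left, norm_smul,
      Real.norm_of_nonneg hr.le]
    exact mul_le_of_le_one_right hr.le (mem_closedBall_zero_iff.1 hx)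
  obtain ⟨x, hx, hlt⟩ := exists_lt_card_of_cube_subset_iUnion hn t
    (W := fun j => A ⁻¹' (O j ∩ ball (q j) (r / 4))) (p := fun j => r⁻¹ • ((q j : Fin n → ℝ) - c))
    (fun j => ((hO j).inter isOpen_ball).preimage hAcont)
    (fun j x hx => by
      have h := hx.2
      rw [mem_ball, ← hAsurj (q j), hAdist] at h
      rw [mem_ball]
      nlinarith)
    (fun x hx => by
      obtain ⟨j, hj, hxj⟩ := mem_iUnion₂.1 (ht (mem_univ (⟨A x, hAK x hx⟩ : K)))
      refine mem_iUnion₂.2 ⟨j, hj, ?_, hq j hxj⟩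
      rw [← hOV j] at hxj
      exact hxj)
  have hcard : ENat.card {j : κ // (⟨A x, hAK x hx⟩ : K) ∈ V j} ≤ n :=
    (hVcard _).trans (Order.add_one_le_of_lt hmn)
  have hsub : {j ∈ (t : Set κ) | x ∈ A ⁻¹' (O j ∩ ball (q j) (r / 4))} ⊆
      {j | (⟨A x, hAK x hx⟩ : K) ∈ V j} := by
    rintro j ⟨-, hj⟩
    rw [mem_ofPred_eq, ← hOV j]
    exact hj.1
  have h₁ := (encard_le_encard hsub).trans hcard
  rw [← (t.finite_toSet.subset (sep_subset _ _)).cast_ncard_eq] at h₁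
  exact hlt.not_ge (by exact_mod_cast h₁)

theorem exists_forall_nhds_not_countable {X : Type*} [TopologicalSpace X]
    [SecondCountableTopology X] (hX : ¬(univ : Set X).Countable) :
    ∃ x : X, ∀ U ∈ 𝓝 x, ¬U.Countable := by
  by_contra! h
  choose U hU hUc using h
  obtain ⟨s, hs, hsU⟩ := TopologicalSpace.countable_cover_nhds hU
  exact hX (hsU ▸ hs.biUnion fun x _ => hUc x)

/-- A continuous map from an uncountable compact metric space to `ℝⁿ` can be uniformly approximated
by maps whose range contains a cube. -/
theorem exists_dist_le_closedBall_subset_range {X : Type*} [MetricSpace X] [CompactSpace X]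
    (hX : ¬(univ : Set X).Countable) {n : ℕ} (f : C(X, Fin n → ℝ)) {ε : ℝ} (hε : 0 < ε) :
    ∃ g : C(X, Fin n → ℝ), dist g f ≤ 2 * ε ∧ ∃ c, closedBall c ε ⊆ range g := by
  obtain ⟨x₀, hx₀⟩ := exists_forall_nhds_not_countable hX
  set N := f ⁻¹' closedBall (f x₀) ε with hN
  have hNc : IsClosed N := isClosed_closedBall.preimage f.continuous
  have hNunc : ¬N.Countable :=
    hx₀ N (f.continuous.continuousAt.preimage_mem_nhds (closedBall_mem_nhds _ hε))
  obtain ⟨e, heN, he, heinj⟩ := hNc.exists_nat_bool_injection_of_not_countable hNunc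
  have : Nonempty (closedBall (f x₀) ε) := ⟨⟨f x₀, mem_closedBall_self hε.le⟩⟩
  have : CompactSpace (closedBall (f x₀) ε) :=
    isCompact_iff_compactSpace.1 (isCompact_closedBall _ _)
  obtain ⟨σ, hσ, hσsurj⟩ := exists_nat_bool_continuous_surjective_of_compact (closedBall (f x₀) ε)
  obtain ⟨d, hd⟩ := ContinuousMap.exists_extension' (he.isClosedEmbedding heinj)
    (⟨fun z => (σ z : Fin n → ℝ) - f (e z), by fun_prop⟩ : C(ℕ → Bool, Fin n → ℝ))
  have hclamp : Continuous (clampCube (2 * ε) : (Fin n → ℝ) → Fin n → ℝ) :=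
    (lipschitzWith_clampCube _).continuous
  refine ⟨⟨fun x => f x + clampCube (2 * ε) (d x), by fun_prop⟩, ?_, f x₀, fun y hy => ?_⟩
  · refine (ContinuousMap.dist_le (by positivity)).2 fun x => ?_
    rw [dist_eq_norm, ContinuousMap.coe_mk, add_sub_cancel_left]
    exact norm_clampCube_le (by positivity) _
  · obtain ⟨z, hz⟩ := hσsurj ⟨y, hy⟩
    have hdz : d (e z) = y - f (e z) := by simpa [hz] using congrFun hd z
    have hle : ‖y - f (e z)‖ ≤ 2 * ε := by
      have h₁ : dist (f (e z)) (f x₀) ≤ ε := heN (mem_range_self z)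
      have h₂ := dist_triangle_right y (f (e z)) (f x₀)
      have h₃ : dist y (f x₀) ≤ ε := hy
      rw [← dist_eq_norm]
      linarith
    exact ⟨e z, by simp [hdz, clampCube_eq_self hle]⟩

theorem stmt5 {X : Type*} [MetricSpace X] [CompactSpace X]
    (hX : ¬(Set.univ : Set X).Countable) (n : ℕ) (hn : 1 ≤ n) :
    Dense {f : C(X, Fin n → ℝ) | covDim ↥(Set.range f) = (n : ℕ∞)} := by
  refine Metric.dense_iff.2 fun f ε hε => ?_
  obtain ⟨g, hg, c, hc⟩ :=
    exists_dist_le_closedBall_subset_range hX f (ε := ε / 3) (by positivity)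
  have hK : IsCompact (range g) := isCompact_range g.continuous
  refine ⟨g, mem_ball.2 (by linarith), le_antisymm (covDim_le_of_isCompact hK ?_)
    (le_covDim_of_closedBall_subset hn hK (by positivity) hc)⟩
  exact ⟨c, hc (mem_closedBall_self (by positivity))⟩
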